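/- arXiv:2212.14522 — 2 statements merged into one kernel-verified Lean document; each statement's English description precedes it below -/
import Mathlib

section
/- The cyclic peak set is cyclic shuffle-compatible: if π, σ are disjoint permutations, π′, σ′ are disjoint permutations, |π| = |π′|, |σ| = |σ′|, cPk[π] = cPk[π′], and cPk[σ] = cPk[σ′], then the multiset {{cPk[τ] : [τ] ∈ [π] ⧢ [σ]}}, where [τ] ranges over the set of cyclic shuffles of [π] and [σ] (each cyclic shuffle counted once), equals the multiset {{cPk[τ] : [τ] ∈ [π′] ⧢ [σ′]}}. -/
/-- A permutation: a list of distinct positive integers. -/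
def IsPerm (π : List ℕ) : Prop := π.Nodup ∧ ∀ x ∈ π, 0 < x

/-- The descent set `Des π = {i ∈ {1,…,n−1} : π_i > π_{i+1}}` (1-based indexing). -/
def Des (π : List ℕ) : Finset ℕ :=
  (Finset.Icc 1 (π.length - 1)).filter fun i => π.getD i 0 < π.getD (i - 1) 0

/-- The descent number. -/
def des (π : List ℕ) : ℕ := (Des π).card

/-- The major index. -/
def maj (π : List ℕ) : ℕ := ∑ i ∈ Des π, i

/-- The cyclic descent set `cDes π = {i ∈ {1,…,n} : π_i > π_{i+1}}`, indices mod `n`. -/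
def cDes (π : List ℕ) : Finset ℕ :=
  (Finset.Icc 1 π.length).filter fun i => π.getD (i % π.length) 0 < π.getD (i - 1) 0

/-- The cyclic descent number. -/
def cdes (π : List ℕ) : ℕ := (cDes π).card

/-- The cyclic major index. -/
def cmaj (π : List ℕ) : ℕ := ∑ i ∈ cDes π, i

/-- The peak set `Pk π = {i ∈ {2,…,n−1} : π_{i−1} < π_i > π_{i+1}}` (1-based indexing). -/
def Pk (π : List ℕ) : Finset ℕ :=
  (Finset.Icc 2 (π.length - 1)).filter fun i =>
    π.getD (i - 2) 0 < π.getD (i - 1) 0 ∧ π.getD i 0 < π.getD (i - 1) 0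

/-- The peak number. -/
def pk (π : List ℕ) : ℕ := (Pk π).card

/-- The cyclic peak set `cPk π = {i ∈ {1,…,n} : π_{i−1} < π_i > π_{i+1}}`, indices mod `n`. -/
def cPk (π : List ℕ) : Finset ℕ :=
  (Finset.Icc 1 π.length).filter fun i =>
    π.getD ((i + π.length - 2) % π.length) 0 < π.getD (i - 1) 0 ∧
      π.getD (i % π.length) 0 < π.getD (i - 1) 0

/-- The cyclic peak number. -/
def cpk (π : List ℕ) : ℕ := (cPk π).card

/-- The cyclic valley set `cVal π = {i ∈ {1,…,n} : π_{i−1} > π_i < π_{i+1}}`, indices mod `n`. -/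
def cVal (π : List ℕ) : Finset ℕ :=
  (Finset.Icc 1 π.length).filter fun i =>
    π.getD (i - 1) 0 < π.getD ((i + π.length - 2) % π.length) 0 ∧
      π.getD (i - 1) 0 < π.getD (i % π.length) 0

/-- The cyclic valley number. -/
def cval (π : List ℕ) : ℕ := (cVal π).card

/-- The distribution of a linear statistic `st` over the `n` rotations of `π`,
i.e. the multiset-valued cyclic statistic induced by `st`, evaluated at `[π]`. -/
def cycStat {A : Type*} (st : List ℕ → A) (π : List ℕ) : Multiset A :=
  (Multiset.range π.length).map fun i => st (π.rotate i)

/-- `τ` is a (linear) shuffle of `π` and `σ`. -/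
def IsShuffle (π σ τ : List ℕ) : Prop :=
  π.Sublist τ ∧ σ.Sublist τ ∧ τ.length = π.length + σ.length

/-- `[τ]` is a cyclic shuffle of `[π]` and `[σ]`: some rotation of `τ` is a shuffle
of some rotation of `π` and some rotation of `σ`. -/
def IsCyclicShuffle (π σ τ : List ℕ) : Prop :=
  ∃ i j k, IsShuffle (π.rotate i) (σ.rotate j) (τ.rotate k)

/-- The set of cyclic shuffles of `[π]` and `[σ]` (as elements of `Cycle ℕ`, so that each
cyclic shuffle is counted once) on which the statistic `cst` takes the value `v`. -/
def cycShuffleFiber {A : Type*} (cst : List ℕ → A) (π σ : List ℕ) (v : A) : Set (Cycle ℕ) :=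
  {c : Cycle ℕ | ∃ τ : List ℕ, (↑τ : Cycle ℕ) = c ∧ IsCyclicShuffle π σ τ ∧ cst τ = v}

/-- A (rotation-invariant) statistic `cst` is cyclic shuffle-compatible if the distribution
of `cst` over the set of cyclic shuffles of `[π]` and `[σ]` (each cyclic shuffle counted
once) depends only on `cst π`, `cst σ`, `|π|` and `|σ|`. -/
def CyclicShuffleCompatible {A : Type*} (cst : List ℕ → A) : Prop :=
  ∀ π σ π' σ' : List ℕ, IsPerm π → IsPerm σ → IsPerm π' → IsPerm σ' →
    π.Disjoint σ → π'.Disjoint σ' →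
    π.length = π'.length → σ.length = σ'.length →
    cst π = cst π' → cst σ = cst σ' →
    ∀ v : A, (cycShuffleFiber cst π σ v).ncard = (cycShuffleFiber cst π' σ' v).ncard


open List

section CyclicAdjacency

variable {α : Type*}

theorem List.IsRotated.filter {l l' : List α} (h : l ~r l') (p : α → Bool) :
    l.filter p ~r l'.filter p := by
  obtain ⟨n, rfl⟩ := h
  rw [List.rotate_eq_drop_append_take_mod, List.filter_append]
  conv_lhs => rw [← List.take_append_drop (n % l.length) l, List.filter_append]
  exact List.isRotated_append

/-- `b` immediately follows `a` in the cyclic list `[l]`. -/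
def CycAdj (l : List α) (a b : α) : Prop := ∃ r, l ~r a :: b :: r

namespace CycAdj

variable {l l' : List α} {a b c : α}

theorem of_isRotated (h : CycAdj l a b) (hl : l ~r l') : CycAdj l' a b :=
  let ⟨r, hr⟩ := h; ⟨r, hl.symm.trans hr⟩

theorem mem_left (h : CycAdj l a b) : a ∈ l := by
  obtain ⟨r, hr⟩ := h
  simp [hr.mem_iff]

theorem mem_right (h : CycAdj l a b) : b ∈ l := by
  obtain ⟨r, hr⟩ := h
  simp [hr.mem_iff]

theorem ne (h : CycAdj l a b) (hl : l.Nodup) : a ≠ b := by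
  obtain ⟨r, hr⟩ := h
  rw [hr.nodup_iff] at hl
  rintro rfl
  simp at hl

theorem two_le_length (h : CycAdj l a b) : 2 ≤ l.length := by
  obtain ⟨r, hr⟩ := h
  simp [hr.perm.length_eq]

theorem filter (h : CycAdj l a b) {p : α → Bool} (ha : p a) (hb : p b) :
    CycAdj (l.filter p) a b := by
  obtain ⟨r, hr⟩ := h
  refine ⟨r.filter p, ?_⟩
  simpa [ha, hb] using hr.filter p

theorem exists_pred (h : CycAdj l a b) : ∃ c, CycAdj l c a := by
  obtain ⟨r, hr⟩ := h
  obtain ⟨s, c, hs⟩ := (List.eq_nil_or_concat (b :: r)).resolve_left (by simp)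
  refine ⟨c, s, ?_⟩
  rw [hs, List.concat_eq_append, ← List.cons_append] at hr
  exact hr.trans (List.isRotated_concat c (a :: s))

theorem exists_succ (h : CycAdj l a b) : ∃ c, CycAdj l b c := by
  obtain ⟨r, hr⟩ := h
  have hr' : l ~r b :: (r ++ [a]) := hr.trans (List.isRotated_concat a (b :: r)).symm
  cases r with
  | nil => exact ⟨a, [], hr'⟩
  | cons c r => exact ⟨c, r ++ [a], hr'⟩

theorem next_eq [DecidableEq α] (h : CycAdj l a b) (hl : l.Nodup) : l.next a h.mem_left = b := by
  obtain ⟨r, hr⟩ := id h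
  rw [List.isRotated_next_eq hr hl, List.next_cons_cons_eq]

theorem prev_eq [DecidableEq α] (h : CycAdj l a b) (hl : l.Nodup) : l.prev b h.mem_right = a := by
  obtain ⟨r, hr⟩ := id h
  rw [List.isRotated_prev_eq hr hl, List.prev_cons_cons_of_ne _ _ _ _ (h.ne hl).symm]

theorem right_unique (hb : CycAdj l a b) (hc : CycAdj l a c) (hl : l.Nodup) : b = c := by
  classical rw [← hb.next_eq hl, hc.next_eq hl]

theorem left_unique (ha : CycAdj l a c) (hb : CycAdj l b c) (hl : l.Nodup) : a = b := by
  classical rw [← ha.prev_eq hl, hb.prev_eq hl]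

theorem getElem {j k : ℕ} (hl : 2 ≤ l.length) (hj : j < l.length) (hk : k < l.length)
    (hjk : k = (j + 1) % l.length) : CycAdj l l[j] l[k] := by
  have h : (l.rotate j).length = l.length := List.length_rotate l j
  match hr : l.rotate j with
  | [] => simp [hr] at h; omega
  | [_] => simp [hr] at h; omega
  | a :: b :: r =>
    have h0 := List.getElem_rotate l j 0 (by omega)
    have h1 := List.getElem_rotate l j 1 (by omega)
    simp only [hr, List.getElem_cons_zero, List.getElem_cons_succ, zero_add] at h0 h1
    refine ⟨r, j, ?_⟩
    simp only [hr, h0, h1, Nat.mod_eq_of_lt hj, hjk, add_comm]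

end CycAdj

end CyclicAdjacency

section Peaks

variable {α : Type*}

/-- The labellings `f` and `g` of the cyclic list `[l]` have the same cyclic ascents. -/
def SameCycAscents (l : List α) (f g : α → ℕ) : Prop :=
  ∀ a b, CycAdj l a b → (f a < f b ↔ g a < g b)

/-- The labellings `f` and `g` of the cyclic list `[l]` have the same cyclic peaks. -/
def SameCycPeaks (l : List α) (f g : α → ℕ) : Prop :=
  ∀ a b c, CycAdj l a b → CycAdj l b c → (f a < f b ∧ f c < f b ↔ g a < g b ∧ g c < g b)

variable {l : List α} {f g h : α → ℕ}

theorem SameCycPeaks.symm (hfg : SameCycPeaks l f g) : SameCycPeaks l g f :=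
  fun a b c hab hbc => (hfg a b c hab hbc).symm

theorem SameCycPeaks.trans (hfg : SameCycPeaks l f g) (hgh : SameCycPeaks l g h) :
    SameCycPeaks l f h :=
  fun a b c hab hbc => (hfg a b c hab hbc).trans (hgh a b c hab hbc)

theorem SameCycAscents.lt_iff_lt (hfg : SameCycAscents l f g) (hl : l.Nodup)
    (hf : f.Injective) (hg : g.Injective) {a b : α} (hab : CycAdj l a b) :
    f b < f a ↔ g b < g a := by
  have h1 := hfg a b hab
  have h2 : f a ≠ f b := hf.ne (hab.ne hl)
  have h3 : g a ≠ g b := hg.ne (hab.ne hl)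
  omega

theorem SameCycAscents.sameCycPeaks (hfg : SameCycAscents l f g) (hl : l.Nodup)
    (hf : f.Injective) (hg : g.Injective) : SameCycPeaks l f g :=
  fun a b _ hab hbc => and_congr (hfg a b hab) (hfg.lt_iff_lt hl hf hg hbc)

theorem mem_cPk_map_iff {i j k : ℕ} (hi : i < l.length) (hj : j < l.length) (hk : k < l.length)
    (hij : j = (i + 1) % l.length) (hjk : k = (j + 1) % l.length) (f : α → ℕ) :
    j + 1 ∈ cPk (l.map f) ↔ f l[i] < f l[j] ∧ f l[k] < f l[j] := by
  have hij' : (j + 1 + l.length - 2) % l.length = i := by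
    rcases Nat.lt_or_ge (i + 1) l.length with h | h
    · rw [Nat.mod_eq_of_lt h] at hij
      rw [show j + 1 + l.length - 2 = i + l.length by omega, Nat.add_mod_right,
        Nat.mod_eq_of_lt hi]
    · rw [show i + 1 = l.length by omega, Nat.mod_self] at hij
      rw [show j + 1 + l.length - 2 = i by omega, Nat.mod_eq_of_lt hi]
  simp [cPk, hij', ← hjk, hi, hj, hk, Nat.succ_le_of_lt hj]

theorem cPk_eq_empty_of_length_le_one {π : List ℕ} (hπ : π.length ≤ 1) : cPk π = ∅ := by
  match π with
  | [] => rfl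
  | [_] => simp [cPk]
  | _ :: _ :: _ => simp at hπ

theorem SameCycPeaks.cPk_map_eq (hfg : SameCycPeaks l f g) : cPk (l.map f) = cPk (l.map g) := by
  rcases Nat.lt_or_ge 1 l.length with hl | hl
  · ext m
    by_cases hm : m ∈ Finset.Icc 1 l.length
    · obtain ⟨j, rfl⟩ : ∃ j, m = j + 1 := ⟨m - 1, by have := Finset.mem_Icc.1 hm; omega⟩
      have hj : j < l.length := (Finset.mem_Icc.1 hm).2
      have hk : (j + 1) % l.length < l.length := Nat.mod_lt _ (by omega)
      obtain ⟨i, hi, hij⟩ : ∃ i < l.length, j = (i + 1) % l.length := by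
        cases j with
        | zero => exact ⟨l.length - 1, by omega, by rw [Nat.sub_add_cancel hl.le, Nat.mod_self]⟩
        | succ i => exact ⟨i, by omega, (Nat.mod_eq_of_lt hj).symm⟩
      rw [mem_cPk_map_iff hi hj hk hij rfl, mem_cPk_map_iff hi hj hk hij rfl]
      exact hfg _ _ _ (CycAdj.getElem hl hi hj hij) (CycAdj.getElem hl hj hk rfl)
    · rw [cPk, cPk, Finset.mem_filter, Finset.mem_filter, List.length_map, List.length_map]
      simp only [hm, false_and]
  · rw [cPk_eq_empty_of_length_le_one (by simpa), cPk_eq_empty_of_length_le_one (by simpa)]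

theorem sameCycPeaks_of_cPk_map_eq (hl : l.Nodup) (h : cPk (l.map f) = cPk (l.map g)) :
    SameCycPeaks l f g := by
  intro a b c hab hbc
  have h2 := hab.two_le_length
  obtain ⟨i, hi, rfl⟩ := List.getElem_of_mem hab.mem_left
  have hj : (i + 1) % l.length < l.length := Nat.mod_lt _ (by omega)
  obtain rfl := (CycAdj.getElem h2 hi hj rfl).right_unique hab hl
  have hk : ((i + 1) % l.length + 1) % l.length < l.length := Nat.mod_lt _ (by omega)
  obtain rfl := (CycAdj.getElem h2 hj hk rfl).right_unique hbc hl
  rw [← mem_cPk_map_iff hi hj hk rfl rfl, ← mem_cPk_map_iff hi hj hk rfl rfl, h]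

theorem SameCycPeaks.of_isRotated {l' : List α} (hfg : SameCycPeaks l f g) (hl : l ~r l') :
    SameCycPeaks l' f g :=
  fun a b c hab hbc => hfg a b c (hab.of_isRotated hl.symm) (hbc.of_isRotated hl.symm)

theorem SameCycPeaks.cycStat_cPk_map_eq (hfg : SameCycPeaks l f g) :
    cycStat cPk (l.map f) = cycStat cPk (l.map g) := by
  simp only [cycStat, List.length_map]
  refine Multiset.map_congr rfl fun i _ => ?_
  rw [← List.map_rotate, ← List.map_rotate]
  exact (hfg.of_isRotated ⟨i, rfl⟩).cPk_map_eq

theorem exists_rotate_cPk_eq {π π' : List ℕ} (hlen : π.length = π'.length)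
    (h : cycStat cPk π = cycStat cPk π') : ∃ i, cPk (π'.rotate i) = cPk π := by
  rcases Nat.eq_zero_or_pos π.length with h0 | h0
  · obtain rfl := List.length_eq_zero_iff.1 h0
    obtain rfl := List.length_eq_zero_iff.1 (hlen.symm.trans h0)
    exact ⟨0, rfl⟩
  · have hmem : cPk π ∈ cycStat cPk π :=
      Multiset.mem_map.2 ⟨0, Multiset.mem_range.2 h0, by rw [List.rotate_zero]⟩
    rw [h] at hmem
    obtain ⟨i, -, hi⟩ := Multiset.mem_map.1 hmem
    exact ⟨i, hi⟩

end Peaks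

section Swap

variable {α : Type*} [DecidableEq α] {l : List α} {f : α → ℕ} {p q : α}

theorem sameCycAscents_comp_swap (hf : f.Injective) (hpq : f p < f q)
    (hbetween : ∀ c, ¬ (f p < f c ∧ f c < f q)) (h1 : ¬ CycAdj l p q) (h2 : ¬ CycAdj l q p) :
    SameCycAscents l f (f ∘ Equiv.swap p q) := by
  intro a b hab
  have ha := hbetween a
  have hb := hbetween b
  have hpa := @hf p a
  have hqa := @hf q a
  have hpb := @hf p b
  have hqb := @hf q b
  simp only [Function.comp_apply, Equiv.swap_apply_def]
  grind

theorem sameCycPeaks_comp_swap (hl : l.Nodup) (hlen : 3 ≤ l.length)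
    (hp : ∀ c, c ≠ p → c ≠ q → f p < f c) (hq : ∀ c, c ≠ p → c ≠ q → f q < f c) :
    SameCycPeaks l f (f ∘ Equiv.swap p q) := by
  intro a b c hab hbc
  have hne : a ≠ c := by
    rintro rfl
    obtain ⟨r, hr⟩ := hab
    cases r with
    | nil => simp [hr.perm.length_eq] at hlen
    | cons d r =>
      have hl' := hr.nodup_iff.1 hl
      have : CycAdj l b d := by
        refine ⟨r ++ [a], hr.trans ?_⟩
        exact (List.isRotated_concat a (b :: d :: r)).symm
      obtain rfl := this.right_unique hbc hl
      simp at hl'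
  have hab' := hab.ne hl
  have hbc' := hbc.ne hl
  simp only [Function.comp_apply, Equiv.swap_apply_def]
  have ha1 := hp a
  have ha2 := hq a
  have hb1 := hp b
  have hb2 := hq b
  have hc1 := hp c
  have hc2 := hq c
  grind

end Swap

section CyclicShuffles

variable {α : Type*} [DecidableEq α]

/-- The arrangements of the letters of `A` and `B` which, restricted to the letters of `A` (of `B`),
are rotations of `A` (of `B`). -/
def cycShuffles (A B : List α) : Set (List α) :=
  {t | t ~ A ++ B ∧ t.filter (· ∈ A) ~r A ∧ t.filter (· ∈ B) ~r B}

/-- The number of lists in `cycShuffles A B` whose labelling by `f` has cyclic peak statistic `v`. -/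
noncomputable def cycShuffleCount (A B : List α) (f : α → ℕ) (v : Multiset (Finset ℕ)) : ℕ :=
  {t ∈ cycShuffles A B | cycStat cPk (t.map f) = v}.ncard

variable {A B t : List α} {f g : α → ℕ} {p q : α}

theorem cycShuffles_comm (A B : List α) : cycShuffles A B = cycShuffles B A := by
  ext t
  simp only [cycShuffles, Set.mem_ofPred_eq]
  rw [(List.perm_append_comm (l₁ := A) (l₂ := B)).congr_right, and_comm (a := _ ~r A)]

theorem cycShuffleCount_comm (A B : List α) : cycShuffleCount A B = cycShuffleCount B A := by
  unfold cycShuffleCount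
  rw [cycShuffles_comm]

theorem nodup_of_mem_cycShuffles (hAB : (A ++ B).Nodup) (ht : t ∈ cycShuffles A B) : t.Nodup :=
  ht.1.nodup_iff.2 hAB

theorem cycShuffles_of_isRotated {t' : List α} (ht : t ∈ cycShuffles A B) (h : t ~r t') :
    t' ∈ cycShuffles A B :=
  ⟨h.perm.symm.trans ht.1, (h.symm.filter _).trans ht.2.1, (h.symm.filter _).trans ht.2.2⟩

theorem CycAdj.of_mem_cycShuffles (ht : t ∈ cycShuffles A B) (h : CycAdj t p q) (hp : p ∈ A)
    (hq : q ∈ A) : CycAdj A p q :=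
  (h.filter (by simpa) (by simpa)).of_isRotated ht.2.1

theorem map_swap_mem_cycShuffles (hAB : (A ++ B).Nodup) (ht : t ∈ cycShuffles A B)
    (h : CycAdj t p q) (hp : p ∈ A) (hq : q ∈ B) :
    t.map (Equiv.swap p q) ∈ cycShuffles A B := by
  have hd := List.disjoint_of_nodup_append hAB
  have hpB : p ∉ B := fun hpB => hd hp hpB
  have hqA : q ∉ A := fun hqA => hd hqA hq
  obtain ⟨r, hr⟩ := h
  have hn := hr.nodup_iff.1 (nodup_of_mem_cycShuffles hAB ht)
  have hmap : r.map (Equiv.swap p q) = r := by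
    conv_rhs => rw [← List.map_id r]
    refine List.map_congr_left fun x hx => Equiv.swap_apply_of_ne_of_ne ?_ ?_ <;>
    · rintro rfl
      simp [hx] at hn
  have hr' : t.map (Equiv.swap p q) ~r q :: p :: r := by
    simpa [hmap] using hr.map (Equiv.swap p q)
  refine cycShuffles_of_isRotated ?_ hr'.symm
  obtain ⟨h1, h2, h3⟩ := cycShuffles_of_isRotated ht hr
  refine ⟨(List.Perm.swap p q r).trans h1, ?_, ?_⟩
  · simpa [hp, hqA] using h2
  · simpa [hq, hpB] using h3

theorem cycShuffleCount_congr_sameCycPeaks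
    (h : ∀ t ∈ cycShuffles A B, SameCycPeaks t f g) :
    cycShuffleCount A B f = cycShuffleCount A B g := by
  ext v
  unfold cycShuffleCount
  congr 1
  ext t
  exact and_congr_right fun ht => by rw [(h t ht).cycStat_cPk_map_eq]

/-- Exchanging two labels that are consecutive in value and not adjacent within `A` or `B` does not
change the distribution. -/
theorem cycShuffleCount_comp_swap (hAB : (A ++ B).Nodup) (hf : f.Injective) (hpq : f p < f q)
    (hbetween : ∀ c, ¬ (f p < f c ∧ f c < f q))
    (hA : ¬ CycAdj A p q ∧ ¬ CycAdj A q p) (hB : ¬ CycAdj B p q ∧ ¬ CycAdj B q p) :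
    cycShuffleCount A B (f ∘ Equiv.swap p q) = cycShuffleCount A B f := by
  classical
  have hmem : ∀ {a b}, (¬ CycAdj A a b) → (¬ CycAdj B a b) → ∀ t ∈ cycShuffles A B,
      CycAdj t a b → t.map (Equiv.swap a b) ∈ cycShuffles A B := by
    intro a b hA hB t ht h
    rcases List.mem_append.1 (ht.1.mem_iff.1 h.mem_left) with ha | ha <;>
    rcases List.mem_append.1 (ht.1.mem_iff.1 h.mem_right) with hb | hb
    · exact (hA (h.of_mem_cycShuffles ht ha hb)).elim
    · exact map_swap_mem_cycShuffles hAB ht h ha hb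
    · rw [cycShuffles_comm] at ht ⊢
      exact map_swap_mem_cycShuffles (List.nodup_append_comm.1 hAB) ht h ha hb
    · rw [cycShuffles_comm] at ht
      exact (hB (h.of_mem_cycShuffles ht ha hb)).elim
  let φ : List α → List α := fun t =>
    if CycAdj t p q ∨ CycAdj t q p then t.map (Equiv.swap p q) else t
  have hφmem : ∀ t ∈ cycShuffles A B, φ t ∈ cycShuffles A B := by
    intro t ht
    by_cases h : CycAdj t p q ∨ CycAdj t q p
    · simp only [φ, if_pos h]
      rcases h with h | h
      · exact hmem hA.1 hB.1 t ht h
      · rw [Equiv.swap_comm]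
        exact hmem hA.2 hB.2 t ht h
    · simpa only [φ, if_neg h]
  have hmap : ∀ t : List α, (t.map (Equiv.swap p q)).map (Equiv.swap p q) = t := by
    intro t
    simp [List.map_map, Function.comp_def]
  have hφ : Function.Involutive φ := by
    intro t
    by_cases h : CycAdj t p q ∨ CycAdj t q p
    · have h' : CycAdj (t.map (Equiv.swap p q)) p q ∨ CycAdj (t.map (Equiv.swap p q)) q p := by
        rcases h with ⟨r, hr⟩ | ⟨r, hr⟩
        · exact Or.inr ⟨r.map (Equiv.swap p q), by simpa using hr.map (Equiv.swap p q)⟩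
        · exact Or.inl ⟨r.map (Equiv.swap p q), by simpa using hr.map (Equiv.swap p q)⟩
      simp only [φ, if_pos h, if_pos h', hmap]
    · simp only [φ, if_neg h]
  have hstat : ∀ t ∈ cycShuffles A B,
      cycStat cPk ((φ t).map f) = cycStat cPk (t.map (f ∘ Equiv.swap p q)) := by
    intro t ht
    by_cases h : CycAdj t p q ∨ CycAdj t q p
    · simp only [φ, if_pos h, List.map_map]
    · simp only [φ, if_neg h]
      rw [not_or] at h
      exact ((sameCycAscents_comp_swap hf hpq hbetween h.1 h.2).sameCycPeaks
        (nodup_of_mem_cycShuffles hAB ht) hf (hf.comp (Equiv.injective _))).cycStat_cPk_map_eq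
  ext v
  unfold cycShuffleCount
  rw [← Set.ncard_image_of_injective _ hφ.injective]
  congr 1
  ext t
  simp only [Set.mem_image, Set.mem_ofPred_eq]
  constructor
  · rintro ⟨t, ⟨ht, rfl⟩, rfl⟩
    exact ⟨hφmem t ht, hstat t ht⟩
  · rintro ⟨ht, rfl⟩
    refine ⟨φ t, ⟨hφmem t ht, ?_⟩, hφ t⟩
    rw [← hstat _ (hφmem t ht), hφ t]

/-- The distribution depends only on the cyclic ascents of the two labelled cyclic lists. -/
theorem cycShuffleCount_congr_sameCycAscents [Fintype α] (hAB : (A ++ B).Nodup)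
    (hf : f.Injective) (hg : g.Injective) (hA : SameCycAscents A f g)
    (hB : SameCycAscents B f g) : cycShuffleCount A B f = cycShuffleCount A B g := by
  have hnA := hAB.of_append_left
  have hnB := hAB.of_append_right
  induction hk : (Finset.univ.filter fun x : α × α => f x.1 < f x.2 ∧ g x.2 < g x.1).card
    using Nat.strong_induction_on generalizing f with
  | _ k ih =>
  set s := Finset.univ.filter fun x : α × α => f x.1 < f x.2 ∧ g x.2 < g x.1 with hs
  rcases s.eq_empty_or_nonempty with h0 | h0
  · refine cycShuffleCount_congr_sameCycPeaks fun t ht => ?_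
    refine SameCycAscents.sameCycPeaks ?_ (nodup_of_mem_cycShuffles hAB ht) hf hg
    have h1 : ∀ a b, f a < f b → g a < g b := by
      intro a b hab
      have h2 : (a, b) ∉ s := by simp [h0]
      have h3 := @hg a b
      simp only [hs, Finset.mem_filter_univ, not_and, not_lt] at h2
      grind
    intro a b hab
    refine ⟨h1 a b, fun h => ?_⟩
    have h3 := h1 b a
    have h4 := @hf a b
    grind
  · obtain ⟨⟨p, q⟩, hpqs, hmin⟩ := s.exists_min_image (fun x => f x.2 - f x.1) h0
    simp only [hs, Finset.mem_filter_univ, Prod.forall] at hpqs hmin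
    obtain ⟨hpq, hgqp⟩ := hpqs
    have hbetween : ∀ c, ¬ (f p < f c ∧ f c < f q) := by
      rintro c ⟨h1, h2⟩
      have h3 := hmin p c
      have h4 := hmin c q
      have h5 := @hg p c
      grind
    have hadj : ∀ l : List α, l.Nodup → SameCycAscents l f g →
        ¬ CycAdj l p q ∧ ¬ CycAdj l q p := by
      refine fun l hl hfg => ⟨fun h => ?_, fun h => ?_⟩
      · have := (hfg p q h).1 hpq
        omega
      · have := (hfg q p h).2 hgqp
        omega
    rw [← cycShuffleCount_comp_swap hAB hf hpq hbetween (hadj A hnA hA) (hadj B hnB hB)]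
    have hsame : ∀ l : List α, l.Nodup → SameCycAscents l f g →
        SameCycAscents l (f ∘ Equiv.swap p q) g := fun l hl hfg a b hab =>
      (sameCycAscents_comp_swap hf hpq hbetween (hadj l hl hfg).1 (hadj l hl hfg).2 a b hab).symm.trans
        (hfg a b hab)
    refine ih _ ?_ (hf.comp (Equiv.injective _)) (hsame A hnA hA) (hsame B hnB hB) rfl
    rw [← hk]
    refine Finset.card_lt_card ((Finset.ssubset_iff_of_subset ?_).2 ⟨(p, q), ?_, ?_⟩)
    · rintro ⟨a, b⟩ hab
      simp only [hs, Finset.mem_filter, Finset.mem_univ, true_and, Function.comp_apply,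
        Equiv.swap_apply_def] at hab ⊢
      clear ih hmin hadj hsame h0 hk
      have ha := hbetween a
      have hb := hbetween b
      have hpa := @hf p a
      have hqa := @hf q a
      have hpb := @hf p b
      have hqb := @hf q b
      grind
    · simp [hs, hpq, hgqp]
    · simp [hpq.le]

end CyclicShuffles

section DoubleDescents

variable {α : Type*} {l : List α} {f g : α → ℕ} {a b c : α}

/-- In the cyclic list `[l]` labelled by `f`, the letter `b` is the middle of two consecutive
descents. -/
def IsCycDoubleDescent (l : List α) (f : α → ℕ) (b : α) : Prop :=
  ∃ a c, CycAdj l a b ∧ CycAdj l b c ∧ f b < f a ∧ f c < f b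

theorem SameCycAscents.isCycDoubleDescent_iff (h : SameCycAscents l f g) (hl : l.Nodup)
    (hf : f.Injective) (hg : g.Injective) :
    IsCycDoubleDescent l f b ↔ IsCycDoubleDescent l g b :=
  exists₂_congr fun _ _ => and_congr_right fun hab => and_congr_right fun hbc =>
    and_congr (h.lt_iff_lt hl hf hg hab) (h.lt_iff_lt hl hf hg hbc)

theorem SameCycPeaks.sameCycAscents (h : SameCycPeaks l f g) (hl : l.Nodup)
    (hf : f.Injective) (hg : g.Injective) (hfd : ∀ b, ¬ IsCycDoubleDescent l f b)
    (hgd : ∀ b, ¬ IsCycDoubleDescent l g b) : SameCycAscents l f g := by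
  intro b c hbc
  obtain ⟨a, hab⟩ := hbc.exists_pred
  have h1 := h a b c hab hbc
  have hf1 := hf.ne (hab.ne hl)
  have hf2 := hf.ne (hbc.ne hl)
  have hg1 := hg.ne (hab.ne hl)
  have hg2 := hg.ne (hbc.ne hl)
  have hf3 : ¬ (f b < f a ∧ f c < f b) := fun h => hfd b ⟨a, c, hab, hbc, h⟩
  have hg3 : ¬ (g b < g a ∧ g c < g b) := fun h => hgd b ⟨a, c, hab, hbc, h⟩
  omega

variable [Fintype α] [DecidableEq α] {A B : List α}

/-- A double descent `p` directly above a valley `q` can be removed by making `p` and `q` the two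
smallest letters, `p` below `q`. -/
theorem exists_remove_isCycDoubleDescent (hAB : (A ++ B).Nodup) (hf : f.Injective)
    {p : α} (hp : IsCycDoubleDescent A f p) :
    ∃ g : α → ℕ, g.Injective ∧ cycShuffleCount A B f = cycShuffleCount A B g ∧
      SameCycPeaks A f g ∧ SameCycAscents B f g ∧ (∃ b, IsCycDoubleDescent A f b ∧
      ¬ IsCycDoubleDescent A g b) ∧ ∀ b, IsCycDoubleDescent A g b → IsCycDoubleDescent A f b := by
  classical
  have hnA := hAB.of_append_left
  obtain ⟨p, hp, hmin⟩ := (Finset.univ.filter (IsCycDoubleDescent A f)).exists_min_image f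
    ⟨p, by simpa⟩
  simp only [Finset.mem_filter_univ] at hp hmin
  obtain ⟨o, q, hop, hpq, hpo, hqp⟩ := id hp
  obtain ⟨r, hqr⟩ := hpq.exists_succ
  have hfqr : f q < f r := by
    have h1 := hf.ne (hqr.ne hnA)
    have h2 : ¬ f r < f q := fun h => by
      have := hmin q ⟨p, r, hpq, hqr, hqp, h⟩
      omega
    omega
  have hpq' := hpq.ne hnA
  have hop' := hop.ne hnA
  have hoq' : o ≠ q := by
    rintro rfl
    omega
  have hlen : 3 ≤ A.length := by
    have hsub : [o, p, q] ⊆ A := by simp [hop.mem_left, hpq.mem_left, hpq.mem_right]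
    exact (List.subperm_of_subset (by simp [hpq', hop', hoq']) hsub).length_le
  let f' : α → ℕ := fun a => if a = q then 0 else if a = p then 1 else f a + 2
  have hf'q : f' q = 0 := if_pos rfl
  have hf'p : f' p = 1 := by simp [f', hpq']
  have hf'a : ∀ a, a ≠ p → a ≠ q → f' a = f a + 2 := fun a h1 h2 => by simp [f', h1, h2]
  have hf' : f'.Injective := by
    intro a b h
    have h1 := @hf a b
    have h2 := hf'a a
    have h3 := hf'a b
    clear_value f'
    clear hmin hp hpq hop hqr
    by_cases ha : a = p <;> by_cases hb : b = p <;> by_cases ha' : a = q <;>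
      by_cases hb' : b = q <;> simp_all
  have hasc : SameCycAscents A f f' := by
    intro a b hab
    have h1 := fun h : b = q => (h ▸ hab).left_unique hpq hnA
    have h2 := fun h : b = p => (h ▸ hab).left_unique hop hnA
    have h3 := fun h : a = p => (h ▸ hab).right_unique hpq hnA
    have h4 := fun h : a = q => (h ▸ hab).right_unique hqr hnA
    have h5 := hf'a a
    have h6 := hf'a b
    have h7 := hqr.ne hnA
    clear_value f'
    clear hmin hp hf' hf'a hf
    by_cases hb : b = q
    · obtain rfl := h1 hb
      subst hb
      omega
    by_cases hb' : b = p
    · obtain rfl := h2 hb'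
      subst hb'
      have := h5 hop' hoq'
      omega
    by_cases ha : a = p
    · exact absurd (h3 ha) hb
    have h6 := h6 hb' hb
    by_cases ha' : a = q
    · obtain rfl := h4 ha'
      subst ha'
      omega
    have h5 := h5 ha ha'
    omega
  have hascB : ∀ g : α → ℕ, (∀ a, a ≠ p → a ≠ q → g a = f a + 2) → SameCycAscents B f g := by
    intro g hg a b hab
    have hd := List.disjoint_of_nodup_append hAB
    have hne : ∀ x ∈ B, x ≠ p ∧ x ≠ q := fun x hx =>
      ⟨fun h => hd hpq.mem_left (h ▸ hx), fun h => hd hpq.mem_right (h ▸ hx)⟩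
    rw [hg a (hne a hab.mem_left).1 (hne a hab.mem_left).2,
      hg b (hne b hab.mem_right).1 (hne b hab.mem_right).2]
    omega
  have hpk : ∀ l : List α, l.Nodup → 3 ≤ l.length → SameCycPeaks l f' (f' ∘ Equiv.swap p q) :=
    fun l hl hl3 => sameCycPeaks_comp_swap hl hl3
      (fun c h1 h2 => by rw [hf'p, hf'a c h1 h2]; omega)
      (fun c h1 h2 => by rw [hf'q, hf'a c h1 h2]; omega)
  have hga : ∀ a, a ≠ p → a ≠ q → (f' ∘ Equiv.swap p q) a = f a + 2 := fun a h1 h2 => by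
    rw [Function.comp_apply, Equiv.swap_apply_of_ne_of_ne h1 h2, hf'a a h1 h2]
  have hgp : (f' ∘ Equiv.swap p q) p = 0 := by simp [hf'q]
  have hgq : (f' ∘ Equiv.swap p q) q = 1 := by simp [hf'p]
  have hginj : (f' ∘ Equiv.swap p q).Injective := hf'.comp (Equiv.injective _)
  have hcount : cycShuffleCount A B f' = cycShuffleCount A B (f' ∘ Equiv.swap p q) := by
    refine cycShuffleCount_congr_sameCycPeaks fun t ht =>
      hpk t (nodup_of_mem_cycShuffles hAB ht) ?_
    rw [ht.1.length_eq, List.length_append]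
    omega
  have hascB' := hascB _ hga
  refine ⟨f' ∘ Equiv.swap p q, hginj, ?_, ?_, hascB', ⟨p, hp, ?_⟩, ?_⟩
  · exact (cycShuffleCount_congr_sameCycAscents hAB hf hf' hasc (hascB f' hf'a)).trans hcount
  · exact (hasc.sameCycPeaks hnA hf hf').trans (hpk A hnA hlen)
  · rintro ⟨a, c, -, -, -, h⟩
    omega
  · rintro b ⟨a, c, hab, hbc, h1, h2⟩
    refine ⟨a, c, hab, hbc, ?_⟩
    generalize f' ∘ Equiv.swap p q = g at *
    have h3 := fun h : b = q => (h ▸ hab).left_unique hpq hnA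
    have h4 := fun h : c = q => (h ▸ hbc).left_unique hpq hnA
    have h5 := fun h : c = p => (h ▸ hbc).left_unique hop hnA
    have h6 := hga a
    have h7 := hga b
    have h8 := hga c
    have hbp : b ≠ p := by
      rintro rfl
      omega
    have hbq : b ≠ q := by
      intro hb
      obtain rfl := h3 hb
      subst hb
      omega
    have hap : a ≠ p := by
      rintro rfl
      omega
    have haq : a ≠ q := by
      rintro rfl
      omega
    have h6 := h6 hap haq
    have h7 := h7 hbp hbq
    by_cases hcp : c = p
    · obtain rfl := h5 hcp
      subst hcp
      omega
    have h8 := h8 hcp fun h => hbp (h4 h)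
    omega

theorem exists_not_isCycDoubleDescent (hAB : (A ++ B).Nodup) (hf : f.Injective) :
    ∃ g : α → ℕ, g.Injective ∧ cycShuffleCount A B f = cycShuffleCount A B g ∧
      SameCycPeaks A f g ∧ SameCycAscents B f g ∧ ∀ b, ¬ IsCycDoubleDescent A g b := by
  classical
  induction hk : (Finset.univ.filter (IsCycDoubleDescent A f)).card
    using Nat.strong_induction_on generalizing f with
  | _ k ih =>
  by_cases h : ∃ p, IsCycDoubleDescent A f p
  · obtain ⟨p, hp⟩ := h
    obtain ⟨g, hg, hcount, hpk, hasc, ⟨b, hbf, hbg⟩, hsub⟩ :=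
      exists_remove_isCycDoubleDescent hAB hf hp
    obtain ⟨g', hg', hcount', hpk', hasc', hd⟩ := ih _ (by
      rw [← hk]
      refine Finset.card_lt_card ((Finset.ssubset_iff_of_subset ?_).2
        ⟨b, by simpa using hbf, by simpa using hbg⟩)
      exact fun x hx => by simpa using hsub x (by simpa using hx)) hg rfl
    exact ⟨g', hg', hcount.trans hcount', hpk.trans hpk',
      fun a b hab => (hasc a b hab).trans (hasc' a b hab), hd⟩
  · exact ⟨f, hf, rfl, fun _ _ _ _ _ => Iff.rfl, fun _ _ _ => Iff.rfl, not_exists.1 h⟩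

/-- The distribution depends only on the cyclic peaks of the two labelled cyclic lists. -/
theorem cycShuffleCount_congr (hAB : (A ++ B).Nodup) (hf : f.Injective) (hg : g.Injective)
    (hA : SameCycPeaks A f g) (hB : SameCycPeaks B f g) :
    cycShuffleCount A B f = cycShuffleCount A B g := by
  have hnA := hAB.of_append_left
  have hnB := hAB.of_append_right
  have key : ∀ f : α → ℕ, f.Injective → ∃ f' : α → ℕ, f'.Injective ∧
      cycShuffleCount A B f = cycShuffleCount A B f' ∧ SameCycPeaks A f f' ∧ SameCycPeaks B f f' ∧
      (∀ b, ¬ IsCycDoubleDescent A f' b) ∧ ∀ b, ¬ IsCycDoubleDescent B f' b := by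
    intro f hf
    obtain ⟨f₁, hf₁, hcount₁, hpk₁, hasc₁, hd₁⟩ := exists_not_isCycDoubleDescent hAB hf
    obtain ⟨f₂, hf₂, hcount₂, hpk₂, hasc₂, hd₂⟩ :=
      exists_not_isCycDoubleDescent (List.nodup_append_comm.1 hAB) hf₁
    rw [cycShuffleCount_comm B A] at hcount₂
    exact ⟨f₂, hf₂, hcount₁.trans hcount₂, hpk₁.trans (hasc₂.sameCycPeaks hnA hf₁ hf₂),
      (hasc₁.sameCycPeaks hnB hf hf₁).trans hpk₂,
      fun b => (hasc₂.isCycDoubleDescent_iff hnA hf₁ hf₂).not.1 (hd₁ b), hd₂⟩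
  obtain ⟨f', hf', hcf, hfA, hfB, hdfA, hdfB⟩ := key f hf
  obtain ⟨g', hg', hcg, hgA, hgB, hdgA, hdgB⟩ := key g hg
  rw [hcf, hcg]
  exact cycShuffleCount_congr_sameCycAscents hAB hf' hg'
    (((hfA.symm.trans hA).trans hgA).sameCycAscents hnA hf' hg' hdfA hdgA)
    (((hfB.symm.trans hB).trans hgB).sameCycAscents hnB hf' hg' hdfB hdgB)

end DoubleDescents

section Cycles

theorem isCyclicShuffle_iff_mem_cycShuffles {π σ τ : List ℕ} (h : (π ++ σ).Nodup) :
    IsCyclicShuffle π σ τ ↔ τ ∈ cycShuffles π σ := by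
  constructor
  · rintro ⟨i, j, k, hπ, hσ, hlen⟩
    have hπσ := (List.rotate_perm π i).append (List.rotate_perm σ j)
    have hperm : π.rotate i ++ σ.rotate j ~ τ.rotate k := by
      refine List.Subperm.perm_of_length_le (List.subperm_of_subset (hπσ.nodup_iff.2 h) ?_)
        (by simp [hlen])
      exact List.append_subset.2 ⟨hπ.subset, hσ.subset⟩
    have hτ : τ ~ π ++ σ := (List.rotate_perm τ k).symm.trans (hperm.symm.trans hπσ)
    have hd := List.disjoint_of_nodup_append h
    have key : ∀ {ρ : List ℕ} {m : ℕ}, ρ.rotate m <+ τ.rotate k →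
        (π ++ σ).filter (· ∈ ρ) = ρ → τ.filter (· ∈ ρ) ~r ρ := by
      intro ρ m hρ hf
      have h1 : ρ.rotate m <+ (τ.rotate k).filter (· ∈ ρ) := by
        have := hρ.filter (· ∈ ρ)
        rwa [List.filter_eq_self.2 (by simp)] at this
      have h2 : ((τ.rotate k).filter (· ∈ ρ)).length = ρ.length := by
        rw [(((List.rotate_perm τ k).trans hτ).filter _).length_eq, hf]
      have h3 := h1.eq_of_length (by simp [h2])
      have h4 : τ.filter (· ∈ ρ) ~r (τ.rotate k).filter (· ∈ ρ) :=
        List.IsRotated.filter ⟨k, rfl⟩ _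
      rw [← h3] at h4
      exact h4.trans (List.IsRotated.symm ⟨m, rfl⟩)
    refine ⟨hτ, key hπ ?_, key hσ ?_⟩
    · rw [List.filter_append, List.filter_eq_self.2 (by simp),
        List.filter_eq_nil_iff.2 (by simpa using fun a ha ha' => hd ha' ha), List.append_nil]
    · rw [List.filter_append, List.filter_eq_nil_iff.2 (by simpa using fun a ha ha' => hd ha ha'),
        List.filter_eq_self.2 (by simp), List.nil_append]
  · rintro ⟨hτ, hπ, hσ⟩
    obtain ⟨i, hi⟩ := hπ.symm
    obtain ⟨j, hj⟩ := hσ.symm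
    refine ⟨i, j, 0, ?_, ?_, ?_⟩
    · rw [hi, List.rotate_zero]
      exact List.filter_sublist
    · rw [hj, List.rotate_zero]
      exact List.filter_sublist
    · simp [hτ.length_eq]

theorem cycShuffles_congr_isRotated {α : Type*} [DecidableEq α] {A B A' B' : List α}
    (hA : A ~r A') (hB : B ~r B') : cycShuffles A B = cycShuffles A' B' := by
  ext t
  simp only [cycShuffles, Set.mem_ofPred_eq, hA.mem_iff, hB.mem_iff]
  refine and_congr ((hA.perm.append hB.perm).congr_right _) (and_congr ?_ ?_)
  · exact ⟨fun h => h.trans hA, fun h => h.trans hA.symm⟩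
  · exact ⟨fun h => h.trans hB, fun h => h.trans hB.symm⟩

theorem cycShuffles_map {α β : Type*} [DecidableEq α] [DecidableEq β] {f : α → β}
    (hf : f.Injective) (A B : List α) :
    cycShuffles (A.map f) (B.map f) = List.map f '' cycShuffles A B := by
  have hrot : ∀ l l' : List α, l.map f ~r l'.map f ↔ l ~r l' := by
    refine fun l l' => ⟨?_, fun h => h.map f⟩
    rintro ⟨n, hn⟩
    rw [← List.map_rotate] at hn
    exact ⟨n, List.map_injective_iff.2 hf hn⟩
  have hmem : ∀ t : List α, t.map f ∈ cycShuffles (A.map f) (B.map f) ↔ t ∈ cycShuffles A B := by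
    intro t
    simp only [cycShuffles, Set.mem_ofPred_eq, ← List.map_append, List.map_perm_map_iff hf,
      List.filter_map, Function.comp_def, List.mem_map_of_injective hf, hrot]
  ext t
  constructor
  · intro ht
    obtain ⟨s, rfl⟩ : ∃ s : List α, s.map f = t := by
      have : ∀ x ∈ t, x ∈ Set.range f := by
        intro x hx
        have := ht.1.mem_iff.1 hx
        rw [← List.map_append] at this
        obtain ⟨a, -, rfl⟩ := List.mem_map.1 this
        exact ⟨a, rfl⟩
      exact Set.mem_range.1 ((Set.range_list_map f).symm ▸ this)
    exact ⟨s, (hmem s).1 ht, rfl⟩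
  · rintro ⟨s, hs, rfl⟩
    exact (hmem s).2 hs

theorem cycShuffleCount_map {α : Type*} [DecidableEq α] {f : α → ℕ} (hf : f.Injective)
    (A B : List α) : cycShuffleCount (A.map f) (B.map f) id = cycShuffleCount A B f := by
  ext v
  unfold cycShuffleCount
  rw [cycShuffles_map hf, ← Set.ncard_image_of_injective _ (List.map_injective_iff.2 hf)]
  congr 1
  ext t
  simp only [Set.mem_image, Set.mem_ofPred_eq, List.map_id]
  constructor
  · rintro ⟨⟨s, hs, rfl⟩, h⟩
    exact ⟨s, ⟨hs, h⟩, rfl⟩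
  · rintro ⟨s, ⟨hs, h⟩, rfl⟩
    exact ⟨⟨s, hs, rfl⟩, h⟩

theorem cycStat_eq_map_cyclicPermutations {A : Type*} (st : List ℕ → A) {π : List ℕ}
    (hπ : π ≠ []) : cycStat st π = ↑(π.cyclicPermutations.map st) := by
  have h : π.cyclicPermutations = (List.range π.length).map π.rotate :=
    List.ext_getElem (by simp [List.length_cyclicPermutations_of_ne_nil _ hπ]) (by simp)
  simp [h, cycStat, ← Multiset.coe_range, Function.comp_def]

theorem cycStat_eq_of_isRotated {A : Type*} (st : List ℕ → A) {π σ : List ℕ} (h : π ~r σ) :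
    cycStat st π = cycStat st σ := by
  rcases eq_or_ne π [] with rfl | hπ
  · rw [List.isRotated_nil_iff'.1 h]
  · have hσ : σ ≠ [] := by
      rintro rfl
      exact hπ (List.isRotated_nil_iff.1 h)
    rw [cycStat_eq_map_cyclicPermutations st hπ, cycStat_eq_map_cyclicPermutations st hσ,
      Multiset.coe_eq_coe]
    exact h.cyclicPermutations.perm.map st

/-- A finite rotation-closed set of distinct-letter lists of length `N` has `N` elements per cycle. -/
theorem ncard_eq_mul_ncard_image_cycle {α : Type*} [DecidableEq α] {s : Set (List α)} {N : ℕ}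
    (hs : s.Finite) (hN : N ≠ 0) (hlen : ∀ l ∈ s, l.length = N) (hnodup : ∀ l ∈ s, l.Nodup)
    (hrot : ∀ l ∈ s, ∀ l', l ~r l' → l' ∈ s) :
    s.ncard = N * ((fun l : List α => (l : Cycle α)) '' s).ncard := by
  lift s to Finset (List α) using hs
  rw [← Finset.coe_image, Set.ncard_coe_finset, Set.ncard_coe_finset,
    Finset.card_eq_sum_card_image (fun l : List α => (l : Cycle α)) s, mul_comm, ← smul_eq_mul,
    ← Finset.sum_const]
  refine Finset.sum_congr rfl fun c hc => ?_
  obtain ⟨l, hl, rfl⟩ := Finset.mem_image.1 hc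
  have hne : l ≠ [] := by
    rintro rfl
    exact hN (hlen _ hl).symm
  have : s.filter (fun l' : List α => (l' : Cycle α) = l) = l.cyclicPermutations.toFinset := by
    ext l'
    simp only [Finset.mem_filter, Cycle.coe_eq_coe, List.mem_toFinset,
      List.mem_cyclicPermutations_iff]
    exact ⟨fun h => h.2, fun h => ⟨hrot l hl l' h.symm, h⟩⟩
  rw [this, List.toFinset_card_of_nodup (hnodup l hl).cyclicPermutations,
    List.length_cyclicPermutations_of_ne_nil _ hne, hlen l hl]

theorem cycShuffleCount_eq_mul_ncard_cycShuffleFiber {π σ : List ℕ} (h : (π ++ σ).Nodup)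
    (hne : π.length + σ.length ≠ 0) (v : Multiset (Finset ℕ)) :
    cycShuffleCount π σ id v =
      (π.length + σ.length) * (cycShuffleFiber (cycStat cPk) π σ v).ncard := by
  unfold cycShuffleCount
  rw [ncard_eq_mul_ncard_image_cycle ?_ hne]
  · congr 2
    ext c
    simp only [cycShuffleFiber, isCyclicShuffle_iff_mem_cycShuffles h, Set.mem_image,
      Set.mem_ofPred_eq, List.map_id]
    exact exists_congr fun τ => and_comm
  · rintro t ⟨ht, -⟩
    rw [ht.1.length_eq, List.length_append]
  · exact fun t ht => nodup_of_mem_cycShuffles h ht.1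
  · rintro t ⟨ht, hv⟩ t' htt'
    rw [List.map_id] at hv
    refine ⟨cycShuffles_of_isRotated ht htt', ?_⟩
    rw [List.map_id, ← cycStat_eq_of_isRotated cPk htt', hv]
  · refine (List.finite_toSet (π ++ σ).permutations).subset ?_
    exact fun t ht => List.mem_permutations.2 ht.1.1

theorem exists_injective_sumElim {π σ : List ℕ} (h : (π ++ σ).Nodup) {n m : ℕ}
    (hn : π.length = n) (hm : σ.length = m) :
    ∃ f : Fin n ⊕ Fin m → ℕ, f.Injective ∧ ((List.finRange n).map Sum.inl).map f = π ∧
      ((List.finRange m).map Sum.inr).map f = σ := by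
  subst hn hm
  refine ⟨Sum.elim π.get σ.get, ?_, ?_, ?_⟩
  · refine Function.Injective.sumElim (List.nodup_iff_injective_get.1 h.of_append_left)
      (List.nodup_iff_injective_get.1 h.of_append_right) fun i j hij => ?_
    exact List.disjoint_of_nodup_append h (List.get_mem π i) (hij ▸ List.get_mem σ j)
  · simp [Function.comp_def]
  · simp [Function.comp_def]

theorem nodup_map_inl_append_map_inr (n m : ℕ) :
    ((List.finRange n).map (Sum.inl : _ → Fin n ⊕ Fin m) ++
      (List.finRange m).map Sum.inr).Nodup := by
  refine List.Nodup.append ((List.nodup_finRange n).map Sum.inl_injective)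
    ((List.nodup_finRange m).map Sum.inr_injective) ?_
  simp [List.Disjoint]

end Cycles

/-- The cyclic peak set `cPk` is cyclic shuffle-compatible. -/
theorem cPk_cyclic_shuffle_compatible : CyclicShuffleCompatible (cycStat cPk) := by
  intro π σ π' σ' hπ hσ hπ' hσ' hd hd' hlπ hlσ hsπ hsσ v
  have hn : (π ++ σ).Nodup := List.Nodup.append hπ.1 hσ.1 hd
  have hn' : (π' ++ σ').Nodup := List.Nodup.append hπ'.1 hσ'.1 hd'
  rcases eq_or_ne (π.length + σ.length) 0 with h0 | h0
  · obtain ⟨h1, h2⟩ := Nat.add_eq_zero_iff.1 h0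
    rw [List.eq_nil_of_length_eq_zero h1, List.eq_nil_of_length_eq_zero h2,
      List.eq_nil_of_length_eq_zero (hlπ.symm.trans h1),
      List.eq_nil_of_length_eq_zero (hlσ.symm.trans h2)]
  refine Nat.eq_of_mul_eq_mul_left (Nat.pos_of_ne_zero h0) ?_
  rw [← cycShuffleCount_eq_mul_ncard_cycShuffleFiber hn h0, hlπ, hlσ,
    ← cycShuffleCount_eq_mul_ncard_cycShuffleFiber hn' (by rwa [← hlπ, ← hlσ])]
  obtain ⟨i, hi⟩ := exists_rotate_cPk_eq hlπ hsπ
  obtain ⟨j, hj⟩ := exists_rotate_cPk_eq hlσ hsσ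
  have hrot : cycShuffleCount π' σ' id = cycShuffleCount (π'.rotate i) (σ'.rotate j) id := by
    unfold cycShuffleCount
    rw [cycShuffles_congr_isRotated (A' := π'.rotate i) (B' := σ'.rotate j) ⟨i, rfl⟩ ⟨j, rfl⟩]
  have hnr : (π'.rotate i ++ σ'.rotate j).Nodup :=
    ((List.rotate_perm π' i).append (List.rotate_perm σ' j)).nodup_iff.2 hn'
  obtain ⟨f, hf, hfπ, hfσ⟩ := exists_injective_sumElim hn rfl rfl
  obtain ⟨g, hg, hgπ, hgσ⟩ := exists_injective_sumElim hnr (n := π.length) (m := σ.length)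
    (by rw [List.length_rotate, hlπ]) (by rw [List.length_rotate, hlσ])
  have hAB := nodup_map_inl_append_map_inr π.length σ.length
  have hcount := cycShuffleCount_congr hAB hf hg
    (sameCycPeaks_of_cPk_map_eq hAB.of_append_left (by rw [hfπ, hgπ, hi]))
    (sameCycPeaks_of_cPk_map_eq hAB.of_append_right (by rw [hfσ, hgσ, hj]))
  rw [← cycShuffleCount_map hf, ← cycShuffleCount_map hg, hfπ, hfσ, hgπ, hgσ] at hcount
  rw [hcount, hrot]
end

section
/- The cyclic descent number cdes is cyclic shuffle-compatible: if π, σ are disjoint permutations, π′, σ′ are disjoint permutations, |π| = |π′|, |σ| = |σ′|, cdes[π] = cdes[π′], and cdes[σ] = cdes[σ′], then the multiset {{cdes[τ] : [τ] ∈ [π] ⧢ [σ]}}, where [τ] ranges over the set of cyclic shuffles of [π] and [σ] (each cyclic shuffle counted once), equals the multiset {{cdes[τ] : [τ] ∈ [π′] ⧢ [σ′]}}. -/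
/-- All shuffles of two lists, enumerated by the choice of first letter. -/
def shuffles : List ℕ → List ℕ → List (List ℕ)
  | [], σ => [σ]
  | a :: π, [] => [a :: π]
  | a :: π, b :: σ =>
    (shuffles π (b :: σ)).map (List.cons a) ++ (shuffles (a :: π) σ).map (List.cons b)
  termination_by π σ => π.length + σ.length

/-- The number of descents of the list `p :: l`. -/
def descentsFrom : ℕ → List ℕ → ℕ
  | _, [] => 0
  | p, a :: l => (if a < p then 1 else 0) + descentsFrom a l

/-- The number of weakly increasing labellings of `l` by `{0, …, k}` that increase strictly at
every descent and use the label `0` on the first letter only if that letter exceeds `p`. -/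
def labellings : ℕ → ℕ → List ℕ → ℕ
  | _, _, [] => 1
  | 0, p, a :: l => if p < a then labellings 0 a l else 0
  | k + 1, p, a :: l => (if p < a then labellings (k + 1) a l else 0) + labellings k 0 (a :: l)
  termination_by k _ l => (k, l.length)

theorem length_le_of_disjoint_sublists {π σ τ : List ℕ} (h : π.Disjoint σ)
    (hπ : π.Sublist τ) (hσ : σ.Sublist τ) : π.length + σ.length ≤ τ.length := by
  have h₁ := (hπ.filter (fun x => decide (x ∈ π))).length_le
  have h₂ := (hσ.filter (fun x => !decide (x ∈ π))).length_le
  rw [List.filter_eq_self.2 (by simp)] at h₁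
  rw [List.filter_eq_self.2 (by simpa using fun a ha hb => h hb ha)] at h₂
  have := List.length_eq_length_filter_add (l := τ) (fun x => decide (x ∈ π))
  omega

theorem mem_shuffles {π σ τ : List ℕ} (h : π.Disjoint σ) :
    τ ∈ shuffles π σ ↔ IsShuffle π σ τ := by
  induction τ generalizing π σ with
  | nil =>
    cases π <;> cases σ <;> simp [shuffles, IsShuffle]
  | cons c τ ih =>
    cases π with
    | nil =>
      simp only [shuffles, List.mem_singleton, IsShuffle, List.nil_sublist, true_and,
        List.length_nil, zero_add]
      constructor
      · rintro rfl; simp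
      · rintro ⟨h₁, h₂⟩; exact (h₁.eq_of_length h₂.symm).symm
    | cons a π =>
      cases σ with
      | nil =>
        simp only [shuffles, List.mem_singleton, IsShuffle, List.nil_sublist, true_and,
          List.length_nil, add_zero]
        constructor
        · intro e; simp [e]
        · rintro ⟨h₁, h₂⟩; exact (h₁.eq_of_length h₂.symm).symm
      | cons b σ =>
        have hab : a ≠ b := by rintro rfl; exact h (by simp) (by simp : a ∈ a :: σ)
        have h₁ : π.Disjoint (b :: σ) := fun x hx => h (List.mem_cons_of_mem a hx)
        have h₂ : (a :: π).Disjoint σ := fun x hx hy => h hx (List.mem_cons_of_mem b hy)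
        simp only [shuffles, List.mem_append, List.mem_map, List.cons.injEq]
        constructor
        · rintro (⟨ρ, hρ, rfl, rfl⟩ | ⟨ρ, hρ, rfl, rfl⟩)
          · obtain ⟨p, q, r⟩ := (ih h₁).1 hρ
            exact ⟨p.cons_cons _, q.cons _, by simp_all; omega⟩
          · obtain ⟨p, q, r⟩ := (ih h₂).1 hρ
            exact ⟨p.cons _, q.cons_cons _, by simp_all; omega⟩
        · rintro ⟨p, q, r⟩
          simp only [List.length_cons] at r
          by_cases hca : c = a
          · subst hca
            refine Or.inl ⟨τ, (ih h₁).2 ⟨by simpa using p, ?_, by simp; omega⟩, rfl, rfl⟩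
            cases q with
            | cons _ q => exact q
            | cons_cons _ q => exact absurd rfl hab
          · by_cases hcb : c = b
            · subst hcb
              refine Or.inr ⟨τ, (ih h₂).2 ⟨?_, by simpa using q, by simp; omega⟩, rfl, rfl⟩
              cases p with
              | cons _ p => exact p
              | cons_cons _ p => exact absurd rfl hab
            · exfalso
              have p' : (a :: π).Sublist τ := by
                cases p with
                | cons _ p => exact p
                | cons_cons _ p => exact absurd rfl hca
              have q' : (b :: σ).Sublist τ := by
                cases q with
                | cons _ q => exact q
                | cons_cons _ q => exact absurd rfl hcb
              have := length_le_of_disjoint_sublists h p' q'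
              simp only [List.length_cons] at this
              omega

theorem nodup_shuffles {π σ : List ℕ} (h : π.Disjoint σ) : (shuffles π σ).Nodup := by
  fun_induction shuffles π σ with
  | case1 => simp
  | case2 => simp
  | case3 a π b σ ih₁ ih₂ =>
    have hab : a ≠ b := by rintro rfl; exact h (by simp) (by simp : a ∈ a :: σ)
    refine List.Nodup.append ((ih₁ fun x hx => h (List.mem_cons_of_mem a hx)).map
      (List.cons_injective)) ((ih₂ fun x hx hy => h hx (List.mem_cons_of_mem b hy)).map
      (List.cons_injective)) ?_
    intro x hx hy
    simp only [List.mem_map] at hx hy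
    obtain ⟨_, _, rfl⟩ := hx
    obtain ⟨_, _, e⟩ := hy
    exact hab (List.cons.inj e).1.symm

theorem IsShuffle.symm {π σ τ : List ℕ} (h : IsShuffle π σ τ) : IsShuffle σ π τ :=
  ⟨h.2.1, h.1, by rw [h.2.2, add_comm]⟩

theorem IsShuffle.filter_eq {π σ τ : List ℕ} (h : IsShuffle π σ τ) {p : ℕ → Bool}
    (hπ : ∀ x ∈ π, p x) (hσ : ∀ x ∈ σ, p x = false) : τ.filter p = π := by
  have h₁ := h.1.filter p
  have h₂ := (h.2.1.filter fun x => !p x).length_le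
  rw [List.filter_eq_self.2 hπ] at h₁
  rw [List.filter_eq_self.2 (by simpa using hσ)] at h₂
  have := List.length_eq_length_filter_add (l := τ) p
  have := h.2.2
  exact (h₁.eq_of_length (le_antisymm h₁.length_le (by omega))).symm

theorem IsShuffle.perm {π σ τ : List ℕ} (hd : π.Disjoint σ) (h : IsShuffle π σ τ) :
    τ.Perm (π ++ σ) := by
  have h₁ : τ.filter (fun x => decide (x ∈ π)) = π :=
    h.filter_eq (by simp) (by simpa using fun a ha hb => hd hb ha)
  have h₂ : τ.filter (fun x => !decide (x ∈ π)) = σ :=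
    h.symm.filter_eq (by simpa using fun a ha hb => hd hb ha) (by simp)
  have := List.filter_append_perm (fun x => decide (x ∈ π)) τ
  rw [h₁, h₂] at this
  exact this.symm

theorem sum_labellings_shuffles {π σ : List ℕ} (h : π.Disjoint σ) (k p : ℕ) :
    ((shuffles π σ).map (labellings k p)).sum = labellings k p π * labellings k p σ := by
  induction k generalizing π σ p with
  | zero =>
    fun_induction shuffles π σ generalizing p with
    | case1 => simp [labellings]
    | case2 => simp [labellings]
    | case3 a π b σ ih₁ ih₂ =>
      have hab : a ≠ b := by rintro rfl; exact h (by simp) (by simp : a ∈ a :: σ)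
      have h₁ := ih₁ (fun x hx => h (List.mem_cons_of_mem a hx)) a
      have h₂ := ih₂ (fun x hx hy => h hx (List.mem_cons_of_mem b hy)) b
      simp only [List.map_append, List.map_map, List.sum_append, Function.comp_def, labellings]
        at h₁ h₂ ⊢
      rcases lt_or_gt_of_ne hab with hlt | hlt <;> by_cases hpa : p < a <;> by_cases hpb : p < b <;>
        first
        | (exfalso; omega)
        | (simp only [hlt, hlt.not_gt, hpa, hpb, if_true, if_false, List.map_const',
            List.sum_replicate, smul_eq_mul, mul_zero, zero_mul, add_zero, zero_add] at h₁ h₂ ⊢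
            <;> linarith)
  | succ k ihk =>
    have key := fun π σ (h : List.Disjoint π σ) => ihk h 0
    clear ihk
    fun_induction shuffles π σ generalizing p with
    | case1 => simp [labellings]
    | case2 => simp [labellings]
    | case3 a π b σ ih₁ ih₂ =>
      have hab : a ≠ b := by rintro rfl; exact h (by simp) (by simp : a ∈ a :: σ)
      have h₁ := ih₁ (fun x hx => h (List.mem_cons_of_mem a hx)) a
      have h₂ := ih₂ (fun x hx hy => h hx (List.mem_cons_of_mem b hy)) b
      have h₃ := key _ _ h
      simp only [shuffles, List.map_append, List.map_map, List.sum_append, Function.comp_def] at h₃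
      simp only [List.map_append, List.map_map, List.sum_append, Function.comp_def, labellings,
        List.sum_map_add] at h₁ h₂ ⊢
      rcases lt_or_gt_of_ne hab with hlt | hlt <;> by_cases hpa : p < a <;> by_cases hpb : p < b <;>
        first
        | (exfalso; omega)
        | (simp only [hlt, hlt.not_gt, hpa, hpb, if_true, if_false, List.map_const',
            List.sum_replicate, smul_eq_mul, mul_zero, zero_add] at h₁ h₂ ⊢
           linarith)

theorem descentsFrom_le_length (p : ℕ) (l : List ℕ) : descentsFrom p l ≤ l.length := by
  induction l generalizing p with
  | nil => simp [descentsFrom]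
  | cons a l ih =>
    have := ih a
    simp only [descentsFrom, List.length_cons]
    split_ifs <;> omega

theorem labellings_eq_choose {l : List ℕ} (hl : l.Nodup) {p : ℕ} (hp : p ∉ l)
    (h0 : ∀ x ∈ l, 0 < x) (k : ℕ) :
    labellings k p l = (k + l.length - descentsFrom p l).choose l.length := by
  fun_induction labellings k p l with
  | case1 => simp
  | case2 p a l hpa ih =>
    rw [ih (List.nodup_cons.1 hl).2 (List.nodup_cons.1 hl).1
      fun x hx => h0 x (List.mem_cons_of_mem a hx)]
    have hd := descentsFrom_le_length a l
    simp only [descentsFrom, hpa.not_gt, if_false, zero_add, List.length_cons]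
    rw [Nat.sub_add_comm hd, Nat.choose_succ_succ]
    rcases Nat.eq_zero_or_pos (descentsFrom a l) with h | h
    · simp [h]
    · rw [Nat.choose_eq_zero_of_lt (by omega), Nat.choose_eq_zero_of_lt (by omega)]
  | case3 p a l hpa =>
    have hap : a < p := lt_of_le_of_ne (not_lt.1 hpa) fun e => hp (by simp [e])
    simp only [descentsFrom, hap, if_true, List.length_cons]
    rw [Nat.choose_eq_zero_of_lt (by omega)]
  | case4 k p a l ih₁ ih₂ =>
    have hd := descentsFrom_le_length a l
    have hne : a ≠ p := fun e => hp (by simp [e])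
    rw [ih₁ (List.nodup_cons.1 hl).2 (List.nodup_cons.1 hl).1
      fun x hx => h0 x (List.mem_cons_of_mem a hx), ih₂ hl (fun h => (h0 0 h).false) h0]
    simp only [descentsFrom, List.length_cons, not_lt_zero, if_false, zero_add]
    rcases lt_or_gt_of_ne hne with h | h
    · simp only [h, h.not_gt, if_true, if_false, zero_add]
      congr 1
      omega
    · simp only [h, h.not_gt, if_true, if_false, zero_add]
      rw [show k + 1 + (l.length + 1) - descentsFrom a l
        = (k + 1 + l.length - descentsFrom a l) + 1 by omega, Nat.choose_succ_succ,
        show k + (l.length + 1) = k + 1 + l.length by omega]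

theorem descentsFrom_eq_sum (p : ℕ) (l : List ℕ) :
    descentsFrom p l =
      ∑ i ∈ Finset.range l.length, if l.getD i 0 < (p :: l).getD i 0 then 1 else 0 := by
  induction l generalizing p with
  | nil => simp [descentsFrom]
  | cons a l ih =>
    rw [List.length_cons, Finset.sum_range_succ', descentsFrom, ih, add_comm]
    simp only [List.getD_cons_succ, List.getD_cons_zero]

theorem descentsFrom_concat (p x : ℕ) (l : List ℕ) :
    descentsFrom p (l ++ [x]) =
      descentsFrom p l + if x < (p :: l).getLast (List.cons_ne_nil p l) then 1 else 0 := by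
  induction l generalizing p with
  | nil => rw [List.nil_append, descentsFrom, descentsFrom, add_comm]; rfl
  | cons a l ih => simp [descentsFrom, ih, add_assoc]

theorem cdes_eq_sum (π : List ℕ) :
    cdes π = ∑ i ∈ Finset.range π.length,
      if π.getD ((i + 1) % π.length) 0 < π.getD i 0 then 1 else 0 := by
  rw [cdes, cDes, Finset.card_filter, Finset.range_eq_Ico, ← Finset.Ico_add_one_right_eq_Icc,
    ← Finset.sum_Ico_add' (fun i => if π.getD (i % π.length) 0 < π.getD (i - 1) 0 then 1 else 0)
      0 π.length 1]
  rfl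

theorem cdes_cons (a : ℕ) (l : List ℕ) : cdes (a :: l) = descentsFrom a (l ++ [a]) := by
  rw [cdes_eq_sum, descentsFrom_eq_sum, List.length_append, List.length_singleton,
    List.length_cons]
  refine Finset.sum_congr rfl fun i hi => ?_
  rw [Finset.mem_range] at hi
  have h₁ : (a :: (l ++ [a])).getD i 0 = (a :: l).getD i 0 := by
    rw [← List.cons_append, List.getD_append _ _ _ _ (by simpa using hi)]
  have h₂ : (l ++ [a]).getD i 0 = (a :: l).getD ((i + 1) % (l.length + 1)) 0 := by
    rcases Nat.lt_or_ge i l.length with h | h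
    · rw [Nat.mod_eq_of_lt (by omega), List.getD_append _ _ _ _ h, List.getD_cons_succ]
    · obtain rfl : i = l.length := by omega
      simp
  rw [h₁, h₂]

theorem cdes_rotate_one (π : List ℕ) : cdes (π.rotate 1) = cdes π := by
  cases π with
  | nil => simp
  | cons a l =>
    rw [List.rotate_cons_succ, List.rotate_zero]
    cases l with
    | nil => rfl
    | cons b l =>
      rw [List.cons_append, cdes_cons, cdes_cons, descentsFrom_concat]
      simp [descentsFrom, add_comm]

theorem cdes_rotate (π : List ℕ) (i : ℕ) : cdes (π.rotate i) = cdes π := by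
  induction i with
  | zero => simp
  | succ i ih => rw [← List.rotate_rotate, cdes_rotate_one, ih]

theorem cdes_le_length (π : List ℕ) : cdes π ≤ π.length := by
  simpa [cdes, cDes] using
    Finset.card_filter_le (Finset.Icc 1 π.length)
      fun i => π.getD (i % π.length) 0 < π.getD (i - 1) 0

theorem le_of_descentsFrom_eq_zero {p : ℕ} {l : List ℕ} (h : descentsFrom p l = 0) :
    ∀ x ∈ l, p ≤ x := by
  induction l generalizing p with
  | nil => simp
  | cons a l ih =>
    simp only [descentsFrom, Nat.add_eq_zero_iff, ite_eq_right_iff, one_ne_zero, imp_false,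
      not_lt] at h
    simp only [List.mem_cons, forall_eq_or_imp]
    exact ⟨h.1, fun x hx => h.1.trans (ih h.2 x hx)⟩

theorem cdes_pos {π : List ℕ} (hπ : π.Nodup) (h : 2 ≤ π.length) : 0 < cdes π := by
  match π, hπ, h with
  | a :: b :: l, hπ, _ =>
    rw [Nat.pos_iff_ne_zero, cdes_cons]
    intro h0
    have h₁ := le_of_descentsFrom_eq_zero h0 b (by simp)
    simp only [List.cons_append, descentsFrom, Nat.add_eq_zero_iff] at h0
    have h₂ := le_of_descentsFrom_eq_zero h0.2 a (by simp)
    simp [le_antisymm h₁ h₂] at hπ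

theorem cdes_eq_zero {π : List ℕ} (h : π.length ≤ 1) : cdes π = 0 := by
  match π, h with
  | [], _ => rfl
  | [a], _ => simp [cdes_cons, descentsFrom]

/-- The number of labellings of all the rotations of a list of length `n` with `c` cyclic
descents. -/
def cyclicLabellings (n c k : ℕ) : ℕ :=
  if n = 0 then 1 else
    c * (k + n - (c - 1)).choose n + (n - c) * (k + n - c).choose n

theorem labellings_rotate_succ {π : List ℕ} (hπ : IsPerm π) {i : ℕ} (hi : i < π.length) (k : ℕ) :
    labellings k 0 (π.rotate (i + 1)) =
      if π.getD ((i + 1) % π.length) 0 < π.getD i 0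
      then (k + π.length - (cdes π - 1)).choose π.length
      else (k + π.length - cdes π).choose π.length := by
  have hn : (π.rotate (i + 1)).Nodup := List.nodup_rotate.2 hπ.1
  have h0 : ∀ x ∈ π.rotate (i + 1), 0 < x := fun x hx => hπ.2 x (List.mem_rotate.1 hx)
  have hlen : (π.rotate (i + 1)).length = π.length := List.length_rotate ..
  rw [labellings_eq_choose hn (fun h => (h0 0 h).false) h0, ← cdes_rotate π (i + 1), hlen]
  have hhead : (π.rotate (i + 1)).getD 0 0 = π.getD ((i + 1) % π.length) 0 := by
    rw [List.getD_eq_getElem _ _ (by omega), List.getElem_rotate,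
      List.getD_eq_getElem _ _ (Nat.mod_lt _ (by omega))]
    simp
  have hlast : (π.rotate (i + 1)).getD (π.length - 1) 0 = π.getD i 0 := by
    rw [List.getD_eq_getElem _ _ (by omega), List.getElem_rotate,
      List.getD_eq_getElem _ _ hi]
    congr 1
    rw [show π.length - 1 + (i + 1) = i + π.length by omega, Nat.add_mod_right,
      Nat.mod_eq_of_lt hi]
  rw [← hhead, ← hlast, ← hlen]
  generalize π.rotate (i + 1) = ρ at *
  cases ρ with
  | nil => simp at hlen; omega
  | cons a l =>
    rw [cdes_cons, descentsFrom_concat]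
    have : (a :: l).getD ((a :: l).length - 1) 0 = (a :: l).getLast (List.cons_ne_nil a l) := by
      rw [List.getD_eq_getElem _ _ (by simp), List.getLast_eq_getElem]
    rw [this]
    simp only [descentsFrom, not_lt_zero, if_false, zero_add, List.getD_cons_zero]
    split_ifs <;> simp

theorem sum_labellings_rotate {π : List ℕ} (hπ : IsPerm π) (k : ℕ) :
    ∑ ρ ∈ π.cyclicPermutations.toFinset, labellings k 0 ρ =
      cyclicLabellings π.length (cdes π) k := by
  rw [List.sum_toFinset _ hπ.1.cyclicPermutations]
  rcases eq_or_ne π [] with rfl | hne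
  · simp [cyclicLabellings, labellings]
  have hlen : π.length ≠ 0 := by simpa using hne
  have h₁ : (π.cyclicPermutations.map (labellings k 0)).sum =
      ∑ i ∈ Finset.range π.length, labellings k 0 (π.rotate i) := by
    have : π.cyclicPermutations = (List.range π.length).map π.rotate := by
      refine List.ext_getElem (by simp [List.length_cyclicPermutations_of_ne_nil _ hne]) ?_
      intro i _ _
      simp
    rw [this, List.map_map]
    rfl
  have h₂ : ∑ i ∈ Finset.range π.length, labellings k 0 (π.rotate i) =
      ∑ i ∈ Finset.range π.length, labellings k 0 (π.rotate (i + 1)) := by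
    have := Finset.sum_range_succ (fun i => labellings k 0 (π.rotate i)) π.length
    rw [Finset.sum_range_succ', List.rotate_length, List.rotate_zero] at this
    omega
  have h₃ : (Finset.card {i ∈ Finset.range π.length |
      π.getD ((i + 1) % π.length) 0 < π.getD i 0}) = cdes π := by
    rw [cdes_eq_sum, Finset.card_filter]
  have h₄ := Finset.card_filter_add_card_filter_not (s := Finset.range π.length)
    fun i => π.getD ((i + 1) % π.length) 0 < π.getD i 0
  rw [h₁, h₂, Finset.sum_congr rfl fun i hi =>
    labellings_rotate_succ hπ (Finset.mem_range.1 hi) k, Finset.sum_ite, Finset.sum_const,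
    Finset.sum_const, cyclicLabellings, if_neg hlen]
  rw [Finset.card_range, h₃] at h₄
  rw [h₃, smul_eq_mul, smul_eq_mul, Nat.eq_sub_of_add_eq' h₄]

/-- All lists that are shuffles of some rotation of `π` and some rotation of `σ`. -/
def rotationShuffles (π σ : List ℕ) : Finset (List ℕ) :=
  (π.cyclicPermutations.toFinset ×ˢ σ.cyclicPermutations.toFinset).biUnion
    fun p => (shuffles p.1 p.2).toFinset

theorem List.Disjoint.of_isRotated {π σ π' σ' : List ℕ} (h : π.Disjoint σ) (hπ : π' ~r π)
    (hσ : σ' ~r σ) : π'.Disjoint σ' :=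
  fun _ hx hy => h (hπ.mem_iff.1 hx) (hσ.mem_iff.1 hy)

theorem mem_rotationShuffles {π σ τ : List ℕ} (h : π.Disjoint σ) :
    τ ∈ rotationShuffles π σ ↔ ∃ π' σ', π' ~r π ∧ σ' ~r σ ∧ IsShuffle π' σ' τ := by
  simp only [rotationShuffles, Finset.mem_biUnion, Finset.mem_product, List.mem_toFinset,
    List.mem_cyclicPermutations_iff, Prod.exists]
  refine exists_congr fun π' => exists_congr fun σ' => ?_
  rw [and_assoc]
  exact and_congr_right fun h₁ => and_congr_right fun h₂ => mem_shuffles (h.of_isRotated h₁ h₂)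

theorem perm_of_mem_rotationShuffles {π σ τ : List ℕ} (h : π.Disjoint σ)
    (hτ : τ ∈ rotationShuffles π σ) : τ.Perm (π ++ σ) := by
  obtain ⟨π', σ', h₁, h₂, h₃⟩ := (mem_rotationShuffles h).1 hτ
  exact (h₃.perm (h.of_isRotated h₁ h₂)).trans (h₁.perm.append h₂.perm)

theorem rotate_one_mem_rotationShuffles {π σ τ : List ℕ} (h : π.Disjoint σ)
    (hτ : τ ∈ rotationShuffles π σ) : τ.rotate 1 ∈ rotationShuffles π σ := by
  rw [mem_rotationShuffles h] at hτ ⊢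
  obtain ⟨π', σ', h₁, h₂, hs⟩ := hτ
  have hd := h.of_isRotated h₁ h₂
  rw [← mem_shuffles hd] at hs
  fun_cases shuffles π' σ' with
  | case1 =>
    simp only [shuffles, List.mem_singleton] at hs
    subst hs
    exact ⟨[], τ.rotate 1, h₁, (List.IsRotated.forall τ 1).trans h₂, by simp [IsShuffle]⟩
  | case2 a π' =>
    simp only [shuffles, List.mem_singleton] at hs
    subst hs
    exact ⟨(a :: π').rotate 1, [], (List.IsRotated.forall _ 1).trans h₁, h₂, by simp [IsShuffle]⟩
  | case3 a π' b σ' =>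
    simp only [shuffles, List.mem_append, List.mem_map] at hs
    rcases hs with ⟨ρ, hρ, rfl⟩ | ⟨ρ, hρ, rfl⟩
    · rw [mem_shuffles fun x hx => hd (List.mem_cons_of_mem a hx)] at hρ
      refine ⟨(a :: π').rotate 1, b :: σ', (List.IsRotated.forall _ 1).trans h₁, h₂, ?_⟩
      simp only [List.rotate_cons_succ, List.rotate_zero]
      refine ⟨hρ.1.append_right [a], hρ.2.1.trans (List.sublist_append_left ..), ?_⟩
      have := hρ.2.2
      simp only [List.length_append, List.length_cons] at this ⊢
      omega
    · rw [mem_shuffles fun x hx hy => hd hx (List.mem_cons_of_mem b hy)] at hρ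
      refine ⟨a :: π', (b :: σ').rotate 1, h₁, (List.IsRotated.forall _ 1).trans h₂, ?_⟩
      simp only [List.rotate_cons_succ, List.rotate_zero]
      refine ⟨hρ.1.trans (List.sublist_append_left ..), hρ.2.1.append_right [b], ?_⟩
      have := hρ.2.2
      simp only [List.length_append, List.length_cons] at this ⊢
      omega

theorem mem_rotationShuffles_of_isRotated {π σ τ τ' : List ℕ} (h : π.Disjoint σ)
    (hr : τ ~r τ') (hτ : τ ∈ rotationShuffles π σ) : τ' ∈ rotationShuffles π σ := by
  obtain ⟨n, rfl⟩ := hr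
  induction n with
  | zero => simpa using hτ
  | succ n ih =>
    rw [← List.rotate_rotate]
    exact rotate_one_mem_rotationShuffles h ih

theorem isCyclicShuffle_iff {π σ τ : List ℕ} (h : π.Disjoint σ) :
    IsCyclicShuffle π σ τ ↔ τ ∈ rotationShuffles π σ := by
  constructor
  · rintro ⟨i, j, k, hs⟩
    exact mem_rotationShuffles_of_isRotated h (List.IsRotated.forall τ k)
      ((mem_rotationShuffles h).2
        ⟨_, _, List.IsRotated.forall π i, List.IsRotated.forall σ j, hs⟩)
  · intro hτ
    obtain ⟨π', σ', h₁, h₂, hs⟩ := (mem_rotationShuffles h).1 hτ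
    obtain ⟨i, rfl⟩ := h₁.symm
    obtain ⟨j, rfl⟩ := h₂.symm
    exact ⟨i, j, 0, by rwa [List.rotate_zero]⟩

theorem sum_labellings_rotationShuffles {π σ : List ℕ} (hπ : IsPerm π) (hσ : IsPerm σ)
    (h : π.Disjoint σ) (k : ℕ) :
    ∑ τ ∈ rotationShuffles π σ, labellings k 0 τ =
      cyclicLabellings π.length (cdes π) k * cyclicLabellings σ.length (cdes σ) k := by
  have hd : ∀ p ∈ π.cyclicPermutations.toFinset ×ˢ σ.cyclicPermutations.toFinset,
      p.1 ~r π ∧ p.2 ~r σ := fun p hp => by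
    simpa only [Finset.mem_product, List.mem_toFinset, List.mem_cyclicPermutations_iff] using hp
  rw [rotationShuffles, Finset.sum_biUnion, ← sum_labellings_rotate hπ k,
    ← sum_labellings_rotate hσ k, Finset.sum_mul_sum, ← Finset.sum_product']
  · refine Finset.sum_congr rfl fun p hp => ?_
    have hp' := h.of_isRotated (hd p hp).1 (hd p hp).2
    rw [List.sum_toFinset _ (nodup_shuffles hp'), sum_labellings_shuffles hp']
  · intro p hp q hq hpq
    rw [Function.onFun, Finset.disjoint_left]
    intro τ hτp hτq
    obtain ⟨hp₁, hp₂⟩ := hd p hp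
    obtain ⟨hq₁, hq₂⟩ := hd q hq
    rw [List.mem_toFinset, mem_shuffles (h.of_isRotated hp₁ hp₂)] at hτp
    rw [List.mem_toFinset, mem_shuffles (h.of_isRotated hq₁ hq₂)] at hτq
    have key : ∀ r : List ℕ × List ℕ, r.1 ~r π → r.2 ~r σ → IsShuffle r.1 r.2 τ →
        r = (τ.filter (fun x => decide (x ∈ π)), τ.filter (fun x => decide (x ∈ σ))) := by
      intro r h₁ h₂ hs
      refine Prod.ext (hs.filter_eq ?_ ?_).symm (hs.symm.filter_eq ?_ ?_).symm
      · simpa using fun x hx => h₁.mem_iff.1 hx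
      · simpa using fun x hx hx' => h hx' (h₂.mem_iff.1 hx)
      · simpa using fun x hx => h₂.mem_iff.1 hx
      · simpa using fun x hx hx' => h (h₁.mem_iff.1 hx) hx'
    exact hpq ((key p hp₁ hp₂ hτp).trans (key q hq₁ hq₂ hτq).symm)

theorem List.IsRotated.cdes_eq {π π' : List ℕ} (h : π ~r π') : cdes π = cdes π' := by
  obtain ⟨n, rfl⟩ := h
  exact (cdes_rotate π n).symm

theorem cycShuffleFiber_cdes {π σ : List ℕ} (h : π.Disjoint σ) (v : ℕ) :
    cycShuffleFiber cdes π σ v =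
      ↑(((rotationShuffles π σ).filter (cdes · = v)).image fun τ : List ℕ => (τ : Cycle ℕ)) := by
  ext c
  simp only [cycShuffleFiber, Set.mem_ofPred_eq, isCyclicShuffle_iff h, Finset.coe_image,
    Finset.coe_filter, Set.mem_image]
  exact exists_congr fun τ => and_comm

theorem sum_ncard_cycShuffleFiber {π σ : List ℕ} (hπ : IsPerm π) (hσ : IsPerm σ)
    (h : π.Disjoint σ) (k : ℕ) :
    ∑ v ∈ Finset.range (π.length + σ.length + 1),
        (cycShuffleFiber cdes π σ v).ncard * cyclicLabellings (π.length + σ.length) v k =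
      cyclicLabellings π.length (cdes π) k * cyclicLabellings σ.length (cdes σ) k := by
  have hout : ∀ τ : List ℕ, (Quotient.out (τ : Cycle ℕ)) ~r τ := fun τ =>
    Quotient.exact (Quotient.out_eq (τ : Cycle ℕ))
  have hperm : ∀ τ ∈ rotationShuffles π σ, IsPerm τ ∧ τ.length = π.length + σ.length := by
    intro τ hτ
    have hp := perm_of_mem_rotationShuffles h hτ
    refine ⟨⟨hp.nodup_iff.2 (List.nodup_append'.2 ⟨hπ.1, hσ.1, h⟩), fun x hx => ?_⟩,
      by simpa using hp.length_eq⟩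
    rcases List.mem_append.1 (hp.mem_iff.1 hx) with hx | hx
    exacts [hπ.2 x hx, hσ.2 x hx]
  rw [← sum_labellings_rotationShuffles hπ hσ h, ← Finset.sum_fiberwise_of_maps_to
      (t := (rotationShuffles π σ).image fun τ : List ℕ => (τ : Cycle ℕ))
      fun τ hτ => Finset.mem_image_of_mem _ hτ,
    ← Finset.sum_fiberwise_of_maps_to (s := (rotationShuffles π σ).image fun τ : List ℕ => (τ : Cycle ℕ))
      (t := Finset.range (π.length + σ.length + 1)) (g := fun c => cdes (Quotient.out c))]
  · refine Finset.sum_congr rfl fun v _ => ?_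
    rw [cycShuffleFiber_cdes h, Set.ncard_coe_finset, ← smul_eq_mul, ← Finset.sum_const]
    refine Finset.sum_congr ?_ fun c hc => ?_
    · ext c
      simp only [Finset.mem_image, Finset.mem_filter]
      constructor
      · rintro ⟨τ, ⟨hτ, rfl⟩, rfl⟩
        exact ⟨⟨τ, hτ, rfl⟩, (hout τ).cdes_eq⟩
      · rintro ⟨⟨τ, hτ, rfl⟩, rfl⟩
        exact ⟨τ, ⟨hτ, (hout τ).cdes_eq.symm⟩, rfl⟩
    · simp only [Finset.mem_image, Finset.mem_filter] at hc
      obtain ⟨⟨τ, hτ, rfl⟩, rfl⟩ := hc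
      rw [(hout τ).cdes_eq, ← (hperm τ hτ).2, ← sum_labellings_rotate (hperm τ hτ).1]
      refine Finset.sum_congr ?_ fun _ _ => rfl
      ext ρ
      rw [List.mem_toFinset, List.mem_cyclicPermutations_iff, Finset.mem_filter, Cycle.coe_eq_coe]
      exact ⟨fun hr => ⟨mem_rotationShuffles_of_isRotated h hr.symm hτ, hr⟩, And.right⟩
  · intro c hc
    obtain ⟨τ, hτ, rfl⟩ := Finset.mem_image.1 hc
    rw [Finset.mem_range, (hout τ).cdes_eq, ← (hperm τ hτ).2]
    exact Nat.lt_succ_of_le (cdes_le_length τ)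

theorem ncard_cycShuffleFiber_eq_zero {π σ : List ℕ} (h : π.Disjoint σ) {v : ℕ}
    (hv : ∀ τ : List ℕ, τ.Perm (π ++ σ) → cdes τ ≠ v) : (cycShuffleFiber cdes π σ v).ncard = 0 := by
  rw [cycShuffleFiber_cdes h, Set.ncard_coe_finset, Finset.card_eq_zero, Finset.image_eq_empty,
    Finset.filter_eq_empty_iff]
  exact fun τ hτ => hv τ (perm_of_mem_rotationShuffles h hτ)

theorem eq_of_triangular {M : ℕ} {a b : ℕ → ℕ} {T : ℕ → ℕ → ℕ}
    (hlt : ∀ u k, k < u → T u k = 0) (hdiag : ∀ u, T u u ≠ 0)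
    (h : ∀ k, ∑ u ∈ Finset.range M, a u * T u k = ∑ u ∈ Finset.range M, b u * T u k) {u : ℕ}
    (hu : u < M) : a u = b u := by
  induction u using Nat.strong_induction_on with
  | _ u ih =>
    have key : ∀ c : ℕ → ℕ, ∑ v ∈ Finset.range M, c v * T v u =
        ∑ v ∈ Finset.range u, c v * T v u + c u * T u u := by
      intro c
      rw [← Finset.sum_range_succ (fun v => c v * T v u)]
      refine (Finset.sum_subset (Finset.range_subset_range.2 hu) fun v _ hv => ?_).symm
      rw [hlt v u (by simpa using hv), mul_zero]
    have := h u
    rw [key, key, Finset.sum_congr rfl fun v hv => by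
      rw [ih v (Finset.mem_range.1 hv) ((Finset.mem_range.1 hv).trans hu)]] at this
    exact Nat.eq_of_mul_eq_mul_right (Nat.pos_of_ne_zero (hdiag u)) (Nat.add_left_cancel this)

theorem cyclicLabellings_succ_eq_zero {n u k : ℕ} (hn : n ≠ 0) (h : k < u) :
    cyclicLabellings n (u + 1) k = 0 := by
  rw [cyclicLabellings, if_neg hn, Nat.choose_eq_zero_of_lt (by omega),
    Nat.choose_eq_zero_of_lt (by omega)]
  simp

theorem cyclicLabellings_succ_self_ne_zero {n u : ℕ} (hn : n ≠ 0) :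
    cyclicLabellings n (u + 1) u ≠ 0 := by
  simp [cyclicLabellings, hn]

/-- The cyclic descent number `cdes` is cyclic shuffle-compatible. -/
theorem cdes_cyclic_shuffle_compatible : CyclicShuffleCompatible cdes := by
  intro π σ π' σ' hπ hσ hπ' hσ' hd hd' hlπ hlσ hcπ hcσ v
  have hsum := sum_ncard_cycShuffleFiber hπ hσ hd
  have hsum' := sum_ncard_cycShuffleFiber hπ' hσ' hd'
  rw [← hlπ, ← hlσ, ← hcπ, ← hcσ] at hsum'
  replace hsum := fun k => (hsum k).trans (hsum' k).symm
  have hlen : ∀ τ : List ℕ, τ.Perm (π ++ σ) → τ.length = π.length + σ.length := fun τ hτ => by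
    simpa using hτ.length_eq
  have hlen' : ∀ τ : List ℕ, τ.Perm (π' ++ σ') → τ.length = π.length + σ.length := fun τ hτ => by
    simpa [hlπ, hlσ] using hτ.length_eq
  generalize π.length + σ.length = n at *
  rcases Nat.lt_or_ge n v with hv | hv
  · rw [ncard_cycShuffleFiber_eq_zero hd, ncard_cycShuffleFiber_eq_zero hd']
    · exact fun τ hτ => ((cdes_le_length τ).trans_lt (hlen' τ hτ ▸ hv)).ne
    · exact fun τ hτ => ((cdes_le_length τ).trans_lt (hlen τ hτ ▸ hv)).ne
  rcases Nat.lt_or_ge n 2 with hn | hn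
  · have hz : ∀ u, (cycShuffleFiber cdes π σ (u + 1)).ncard = 0 := fun u =>
      ncard_cycShuffleFiber_eq_zero hd fun τ hτ => by
        rw [cdes_eq_zero (by rw [hlen τ hτ]; omega)]; omega
    have hz' : ∀ u, (cycShuffleFiber cdes π' σ' (u + 1)).ncard = 0 := fun u =>
      ncard_cycShuffleFiber_eq_zero hd' fun τ hτ => by
        rw [cdes_eq_zero (by rw [hlen' τ hτ]; omega)]; omega
    cases v with
    | succ u => rw [hz, hz']
    | zero =>
      have := hsum 0
      simp only [Finset.sum_range_succ', hz, hz', zero_mul, Finset.sum_const_zero, zero_add] at this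
      interval_cases n <;> simpa [cyclicLabellings] using this
  · have hz : (cycShuffleFiber cdes π σ 0).ncard = 0 :=
      ncard_cycShuffleFiber_eq_zero hd fun τ hτ => (cdes_pos (hτ.nodup_iff.2
        (List.nodup_append'.2 ⟨hπ.1, hσ.1, hd⟩)) (by rwa [hlen τ hτ])).ne'
    have hz' : (cycShuffleFiber cdes π' σ' 0).ncard = 0 :=
      ncard_cycShuffleFiber_eq_zero hd' fun τ hτ => (cdes_pos (hτ.nodup_iff.2
        (List.nodup_append'.2 ⟨hπ'.1, hσ'.1, hd'⟩)) (by rwa [hlen' τ hτ])).ne'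
    cases v with
    | zero => rw [hz, hz']
    | succ u =>
      refine eq_of_triangular (M := n) (a := fun u => (cycShuffleFiber cdes π σ (u + 1)).ncard)
        (b := fun u => (cycShuffleFiber cdes π' σ' (u + 1)).ncard)
        (T := fun u k => cyclicLabellings n (u + 1) k)
        (fun _ _ => cyclicLabellings_succ_eq_zero (by omega))
        (fun _ => cyclicLabellings_succ_self_ne_zero (by omega)) (fun k => ?_) hv
      simpa only [Finset.sum_range_succ', hz, hz', zero_mul, add_zero] using hsum k
end
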